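/- Let G ⊆ K^r_n with n sufficiently large (n ≥ (4q)^{90q(2q)^r(6·binom(q,r))^2}), and suppose the complement K^r_n \ G is c-bounded with c < 2^{-3q}. Then there exists a probability-style fractional assignment p: K^r_q(G) → [0,1] such that Σ{p_Q : e ∈ Q ∈ K^r_q(G)} = 1/2 for every edge e of G. -/

import Mathlib

open Finset

theorem sum_powersetCard_card_inter {α : Type*} [DecidableEq α] {T W : Finset α} (hT : T ⊆ W)
    (k : ℕ) (F : ℕ → ℝ) :
    ∑ X ∈ powersetCard k W, F #(X ∩ T) =
      ∑ p ∈ antidiagonal k, ((#T).choose p.1 : ℝ) * ((#(W \ T)).choose p.2 : ℝ) * F p.1 := by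
  have hmaps : ∀ X ∈ powersetCard k W, (#(X ∩ T), #(X \ T)) ∈ antidiagonal k := by
    intro X hX
    rw [HasAntidiagonal.mem_antidiagonal, card_inter_add_card_sdiff]
    exact (mem_powersetCard.1 hX).2
  rw [← sum_fiberwise_of_maps_to hmaps]
  refine sum_congr rfl fun p hp => ?_
  have hconst : ∀ X ∈ (powersetCard k W).filter (fun X => (#(X ∩ T), #(X \ T)) = p),
      F #(X ∩ T) = F p.1 := by
    intro X hX
    rw [← (mem_filter.1 hX).2]
  rw [sum_congr rfl hconst, sum_const, nsmul_eq_mul]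
  congr 1
  rw [← card_powersetCard, ← card_powersetCard, ← Nat.cast_mul, ← card_product]
  congr 1
  refine card_nbij' (fun X => (X ∩ T, X \ T)) (fun Y => Y.1 ∪ Y.2) ?_ ?_ ?_ ?_
  · intro X hX
    simp only [coe_filter, mem_powersetCard, Set.mem_ofPred_eq] at hX
    obtain ⟨⟨h1, h2⟩, rfl⟩ := hX
    simp only [coe_product, Set.mem_prod, mem_coe, mem_powersetCard, and_true]
    exact ⟨inter_subset_right, sdiff_subset_sdiff h1 le_rfl⟩
  · rintro ⟨A, B⟩ h
    simp only [coe_product, Set.mem_prod, mem_coe, mem_powersetCard] at h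
    obtain ⟨⟨hA, hA'⟩, hB, hB'⟩ := h
    have hd : Disjoint A B := disjoint_of_subset_left hA (disjoint_of_subset_right hB disjoint_sdiff)
    have e1 : (A ∪ B) ∩ T = A := by
      ext x
      have := @hA x
      have := @hB x
      simp only [mem_inter, mem_union, mem_sdiff] at *
      tauto
    have e2 : (A ∪ B) \ T = B := by
      ext x
      have := @hA x
      have := @hB x
      simp only [mem_union, mem_sdiff] at *
      tauto
    simp only [coe_filter, mem_powersetCard, Set.mem_ofPred_eq, e1, e2, card_union_of_disjoint hd,
      hA', hB']
    exact ⟨⟨union_subset (hA.trans hT) (hB.trans sdiff_subset), HasAntidiagonal.mem_antidiagonal.1 hp⟩, trivial⟩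
  · intro X _
    ext x
    simp only [mem_inter, mem_union, mem_sdiff]
    tauto
  · rintro ⟨A, B⟩ h
    simp only [coe_product, Set.mem_prod, mem_coe, mem_powersetCard] at h
    obtain ⟨⟨hA, hA'⟩, hB, hB'⟩ := h
    refine Prod.ext ?_ ?_
    · ext x
      have := @hA x
      have := @hB x
      simp only [mem_inter, mem_union, mem_sdiff] at *
      tauto
    · ext x
      have := @hA x
      have := @hB x
      simp only [mem_union, mem_sdiff] at *
      tauto

theorem sum_choose_mul_neg_one_pow_mul_choose {d : ℕ} (hd : 0 < d) (m : ℕ) :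
    ∑ p ∈ antidiagonal m, (d.choose p.1 : ℝ) * ((-1) ^ p.2 * ((d + p.2 - 1).choose p.2 : ℝ)) =
      if m = 0 then 1 else 0 := by
  have h := Ring.add_choose_eq (r := (d : ℤ)) (s := -(d : ℤ)) m (Commute.all _ _)
  rw [add_neg_cancel, Ring.choose_zero_ite] at h
  have h2 : ∑ p ∈ antidiagonal m, (d.choose p.1 : ℤ) *
      ((-1) ^ p.2 * ((d + p.2 - 1).choose p.2 : ℤ)) = if m = 0 then 1 else 0 := by
    rw [h]
    refine sum_congr rfl fun p _ => ?_
    rw [Ring.choose_natCast, Ring.choose_neg]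
    have : (d : ℤ) + p.2 - 1 = ((d + p.2 - 1 : ℕ) : ℤ) := by omega
    rw [this, Ring.choose_natCast, Units.smul_def, Int.coe_negOnePow_natCast]
    simp
  have h3 := congrArg (Int.cast : ℤ → ℝ) h2
  push_cast at h3
  exact h3

/-- The value at `Q` of the local decoder of an `r`-set `e` inside a `(q + r)`-set containing both,
as a function of `i = #(Q ∩ e)`. -/
noncomputable def decoderWeight (q r i : ℕ) : ℝ :=
  (-1) ^ (r - i) * ((q - 1 - i).choose (r - i) : ℝ) / ((r.choose i : ℝ) * (q.choose r : ℝ))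

theorem sum_antidiagonal_decoderWeight {q r j : ℕ} (hqr : r < q) (hj : j ≤ r) :
    ∑ p ∈ antidiagonal (q - r), ((r - j).choose p.1 : ℝ) * ((q - r + j).choose p.2 : ℝ) *
      decoderWeight q r (j + p.1) = if j = r then 1 else 0 := by
  obtain ⟨m, rfl⟩ := Nat.exists_eq_add_of_le hj
  obtain ⟨d, rfl⟩ := Nat.exists_eq_add_of_le hqr.le
  have hd : 0 < d := by omega
  have hV := sum_choose_mul_neg_one_pow_mul_choose hd m
  rw [Nat.sum_antidiagonal_eq_sum_range_succ_mk] at hV ⊢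
  simp only [Nat.add_sub_cancel_left]
  set A : ℝ := ((d + j).choose j : ℝ) / (((j + m).choose j : ℝ) * ((j + m + d).choose (j + m) : ℝ))
    with hA
  have hterm : ∀ s ≤ m, s ≤ d →
      (m.choose s : ℝ) * ((d + j).choose (d - s) : ℝ) * decoderWeight (j + m + d) (j + m) (j + s) =
        A * ((d.choose s : ℝ) * ((-1) ^ (m - s) * ((d + (m - s) - 1).choose (m - s) : ℝ))) := by
    intro s hsm hsd
    have e1 : (d + j).choose (d - s) = (d + j).choose (j + s) := by
      rw [← Nat.choose_symm (show d - s ≤ d + j by omega)]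
      congr 1
      omega
    have e2 : (d + j).choose (j + s) * (j + s).choose j = (d + j).choose j * d.choose s := by
      have := Nat.choose_mul (n := d + j) (k := j + s) (s := j) (by omega)
      simpa using this
    have e3 : (j + m).choose (j + s) * (j + s).choose j = (j + m).choose j * m.choose s := by
      have := Nat.choose_mul (n := j + m) (k := j + s) (s := j) (by omega)
      simpa using this
    have e4 : j + m - (j + s) = m - s := by omega
    have e5 : j + m + d - 1 - (j + s) = d + (m - s) - 1 := by omega
    have p1 : ((j + m).choose (j + s) : ℝ) ≠ 0 := by
      exact_mod_cast (Nat.choose_pos (by omega)).ne'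
    have p2 : ((j + m).choose j : ℝ) ≠ 0 := by
      exact_mod_cast (Nat.choose_pos (by omega)).ne'
    have p3 : ((j + m + d).choose (j + m) : ℝ) ≠ 0 := by
      exact_mod_cast (Nat.choose_pos (by omega)).ne'
    have e2' : ((d + j).choose (j + s) : ℝ) * (j + s).choose j = (d + j).choose j * d.choose s := by
      exact_mod_cast e2
    have e3' : ((j + m).choose (j + s) : ℝ) * (j + s).choose j = (j + m).choose j * m.choose s := by
      exact_mod_cast e3
    have p4 : ((j + s).choose j : ℝ) ≠ 0 := by
      exact_mod_cast (Nat.choose_pos (by omega)).ne'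
    have key : (m.choose s : ℝ) * (d + j).choose (j + s) * (j + m).choose j =
        (d + j).choose j * d.choose s * (j + m).choose (j + s) := by
      apply mul_right_cancel₀ p4
      linear_combination (m.choose s : ℝ) * (j + m).choose j * e2' -
        ((d + j).choose j : ℝ) * d.choose s * e3'
    rw [e1, decoderWeight, e4, e5, hA]
    field_simp
    linear_combination ((d + (m - s) - 1).choose (m - s) : ℝ) * key
  have hL : ∑ s ∈ range (min m d + 1), (m.choose s : ℝ) * ((d + j).choose (d - s) : ℝ) *
      decoderWeight (j + m + d) (j + m) (j + s) = ∑ s ∈ range (d + 1), (m.choose s : ℝ) *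
        ((d + j).choose (d - s) : ℝ) * decoderWeight (j + m + d) (j + m) (j + s) := by
    refine sum_subset (range_subset_range.2 (by omega)) fun s h1 h2 => ?_
    rw [mem_range] at h1 h2
    rw [Nat.choose_eq_zero_of_lt (show m < s by omega)]
    simp
  have hR : ∑ s ∈ range (min m d + 1),
      (d.choose s : ℝ) * ((-1) ^ (m - s) * ((d + (m - s) - 1).choose (m - s) : ℝ)) =
        ∑ s ∈ range (m + 1),
          (d.choose s : ℝ) * ((-1) ^ (m - s) * ((d + (m - s) - 1).choose (m - s) : ℝ)) := by
    refine sum_subset (range_subset_range.2 (by omega)) fun s h1 h2 => ?_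
    rw [mem_range] at h1 h2
    rw [Nat.choose_eq_zero_of_lt (show d < s by omega)]
    simp
  rw [← hL, sum_congr rfl fun s hs => hterm s (by rw [mem_range] at hs; omega)
    (by rw [mem_range] at hs; omega), ← mul_sum, hR, hV]
  rcases Nat.eq_zero_or_pos m with rfl | hm
  · have : ((j + d).choose j : ℝ) ≠ 0 := by
      exact_mod_cast (Nat.choose_pos (by omega)).ne'
    simp only [hA, add_zero, Nat.choose_self, Nat.cast_one, one_mul, if_true, mul_one]
    rw [add_comm d j, div_self this]
  · rw [if_neg hm.ne', if_neg (by omega), mul_zero]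

theorem sum_decoderWeight {α : Type*} [DecidableEq α] {q r : ℕ} (hqr : r < q) {V e f : Finset α}
    (hV : #V = q + r) (he : #e = r) (hf : #f = r) (heV : e ⊆ V) (hfV : f ⊆ V) :
    ∑ Q ∈ (powersetCard q V).filter (f ⊆ ·), decoderWeight q r #(Q ∩ e) =
      if e = f then 1 else 0 := by
  rw [filter_powersetCard_subset f V q hfV (by omega), sum_image, hf]
  · have hj := card_sdiff_add_card_inter e f
    have hT : #(e \ f) = r - #(e ∩ f) := by omega
    have hW : #((V \ f) \ (e \ f)) = q - r + #(e ∩ f) := by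
      rw [card_sdiff_of_subset (sdiff_subset_sdiff heV le_rfl), card_sdiff_of_subset hfV]
      omega
    have hjr : #(e ∩ f) ≤ r := by omega
    have hterm : ∀ X ∈ powersetCard (q - r) (V \ f), decoderWeight q r #((X ∪ f) ∩ e) =
        decoderWeight q r (#(e ∩ f) + #(X ∩ (e \ f))) := by
      intro X hX
      rw [mem_powersetCard] at hX
      congr 1
      rw [← card_union_of_disjoint]
      · congr 1
        ext x
        have := @hX.1 x
        simp only [mem_inter, mem_union, mem_sdiff] at *
        tauto
      · rw [disjoint_left]
        intro x
        simp only [mem_inter, mem_sdiff]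
        tauto
    rw [sum_congr rfl hterm, sum_powersetCard_card_inter (sdiff_subset_sdiff heV le_rfl) (q - r)
      (fun i => decoderWeight q r (#(e ∩ f) + i)), hT, hW, sum_antidiagonal_decoderWeight hqr hjr]
    congr 1
    rw [eq_iff_iff]
    constructor
    · intro h
      have h1 : e ∩ f = e := eq_of_subset_of_card_le inter_subset_left (by omega)
      exact eq_of_subset_of_card_le (inter_eq_left.1 h1) (by omega)
    · rintro rfl
      rwa [inter_self]
  · intro X hX Y hY h
    rw [mem_coe, mem_powersetCard] at hX hY
    ext x
    have h1 := @hX.1 x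
    have h2 := @hY.1 x
    have h3 := Finset.ext_iff.1 h x
    simp only [mem_union, mem_sdiff] at *
    tauto

theorem sum_abs_decoderWeight_le {α : Type*} [DecidableEq α] {q r : ℕ} (hqr : r < q)
    {V Q : Finset α} (hV : #V = q + r) (hQ : #Q = q) (hQV : Q ⊆ V) :
    ∑ e ∈ powersetCard r V, |decoderWeight q r #(Q ∩ e)| ≤ 2 ^ r := by
  have h := sum_powersetCard_card_inter hQV r (fun i => |decoderWeight q r i|)
  have hr : #(V \ Q) = r := by
    rw [card_sdiff_of_subset hQV]
    omega
  simp only [inter_comm _ Q] at h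
  rw [h, hr, hQ]
  have h2 : (2 : ℝ) ^ r = ∑ p ∈ antidiagonal r, (r.choose p.1 : ℝ) := by
    rw [Nat.sum_antidiagonal_eq_sum_range_succ_mk]
    exact_mod_cast (Nat.sum_range_choose r).symm
  rw [h2]
  refine sum_le_sum fun p hp => ?_
  rw [HasAntidiagonal.mem_antidiagonal] at hp
  obtain ⟨i, t⟩ := p
  simp only at hp ⊢
  have e1 : r.choose t = r.choose i := Nat.choose_symm_of_eq_add (by omega)
  have hri : r - i = t := by omega
  have e2 := Nat.choose_mul (n := q) (k := r) (s := i) (by omega)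
  rw [hri] at e2
  have e2' : (q.choose r : ℝ) * r.choose i = q.choose i * (q - i).choose t := by exact_mod_cast e2
  have e3 : ((q - 1 - i).choose t : ℝ) ≤ (q - i).choose t := by
    exact_mod_cast Nat.choose_le_choose t (by omega)
  have p1 : (0 : ℝ) < r.choose i := by exact_mod_cast Nat.choose_pos (by omega)
  have p2 : (0 : ℝ) < q.choose r := by exact_mod_cast Nat.choose_pos (by omega)
  rw [decoderWeight, abs_div, abs_mul, abs_pow, abs_neg, abs_one, one_pow, one_mul, hri, e1,
    Nat.abs_cast, abs_of_pos (mul_pos p1 p2), mul_div_assoc', div_le_iff₀ (mul_pos p1 p2)]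
  calc (q.choose i : ℝ) * r.choose i * (q - 1 - i).choose t
      ≤ (q.choose i : ℝ) * r.choose i * (q - i).choose t := by gcongr
    _ = r.choose i * (r.choose i * q.choose r) := by linear_combination -(r.choose i : ℝ) * e2'

/-- The `m`-subsets of `[n]` all of whose `r`-subsets lie in `G`. -/
def cliqueSets {n : ℕ} (G : Finset (Finset (Fin n))) (r m : ℕ) : Finset (Finset (Fin n)) :=
  (powersetCard m univ).filter fun Q => ∀ f ⊆ Q, #f = r → f ∈ G

theorem mem_cliqueSets {n r m : ℕ} {G : Finset (Finset (Fin n))} {Q : Finset (Fin n)} :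
    Q ∈ cliqueSets G r m ↔ #Q = m ∧ ∀ f ⊆ Q, #f = r → f ∈ G := by
  simp [cliqueSets, mem_powersetCard]

theorem card_filter_superset {n m r : ℕ} {f : Finset (Fin n)} (hf : #f = r) (hrm : r ≤ m) :
    #((powersetCard m univ).filter (f ⊆ ·)) = (n - r).choose (m - r) := by
  rw [card_filter_powersetCard_subset f univ m (subset_univ f) (by omega), hf, card_univ,
    Fintype.card_fin]

theorem choose_le_card_cliqueSets_add {n r m : ℕ} {G : Finset (Finset (Fin n))} {b : ℝ}
    (hrm : r < m)
    (hbound : ∀ g : Finset (Fin n), #g = r - 1 →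
      (#(univ.filter fun e : Finset (Fin n) => #e = r ∧ g ⊆ e ∧ e ∉ G) : ℝ) ≤ b)
    {f : Finset (Fin n)} (hfG : f ∈ G) (hf : #f = r) (hr : 1 ≤ r) :
    ((n - r).choose (m - r) : ℝ) ≤ #((cliqueSets G r m).filter (f ⊆ ·)) +
      ((n - r).choose (m - 1 - r) : ℝ) * ((m - 1).choose (r - 1) : ℝ) * b := by
  classical
  set S := (powersetCard m (univ : Finset (Fin n))).filter (f ⊆ ·) with hS
  set B := S.filter fun Q => Q ∉ cliqueSets G r m with hB
  set T := (powersetCard (m - 1) (univ : Finset (Fin n))).filter (f ⊆ ·) with hT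
  let N : Finset (Fin n) → Finset (Finset (Fin n)) := fun g =>
    univ.filter fun e => #e = r ∧ g ⊆ e ∧ e ∉ G
  have hsub : B ⊆ T.biUnion fun Q => (powersetCard (r - 1) Q).biUnion fun g =>
      (N g).image (Q ∪ ·) := by
    intro Q hQ
    rw [hB, mem_filter, hS, mem_filter, mem_powersetCard, mem_cliqueSets] at hQ
    obtain ⟨⟨⟨-, hQm⟩, hfQ⟩, hbad⟩ := hQ
    have hbad' : ∃ h ⊆ Q, #h = r ∧ h ∉ G := by
      by_contra! hcon
      exact hbad ⟨hQm, hcon⟩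
    obtain ⟨h, hhQ, hhr, hhG⟩ := hbad'
    have hnot : ¬ h ⊆ f := by
      intro hhf
      rw [eq_of_subset_of_card_le hhf (by omega)] at hhG
      exact hhG hfG
    obtain ⟨v, hvh, hvf⟩ := not_subset.1 hnot
    simp only [mem_biUnion, mem_image]
    refine ⟨Q.erase v, ?_, h.erase v, ?_, h, ?_, ?_⟩
    · rw [hT, mem_filter, mem_powersetCard, card_erase_of_mem (hhQ hvh), hQm]
      exact ⟨⟨subset_univ _, rfl⟩, subset_erase.2 ⟨hfQ, hvf⟩⟩
    · rw [mem_powersetCard, card_erase_of_mem hvh, hhr]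
      exact ⟨erase_subset_erase v hhQ, rfl⟩
    · simp only [N, mem_filter, mem_univ, true_and]
      exact ⟨hhr, erase_subset v h, hhG⟩
    · ext x
      have := @hhQ x
      by_cases hx : x = v
      · subst hx
        simp [hvh, hhQ hvh]
      · simp only [mem_union, mem_erase]
        tauto
  have hBle : (#B : ℝ) ≤ ((n - r).choose (m - 1 - r) : ℝ) * ((m - 1).choose (r - 1) : ℝ) * b := by
    have h1 : (#B : ℝ) ≤ ∑ Q ∈ T, ∑ g ∈ powersetCard (r - 1) Q, (#(N g) : ℝ) := by
      have : #B ≤ ∑ Q ∈ T, ∑ g ∈ powersetCard (r - 1) Q, #(N g) :=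
        (card_le_card hsub).trans <| card_biUnion_le.trans <| sum_le_sum fun Q _ =>
          card_biUnion_le.trans <| sum_le_sum fun g _ => card_image_le
      exact_mod_cast this
    refine h1.trans ?_
    have h2 : ∀ Q ∈ T, ∑ g ∈ powersetCard (r - 1) Q, (#(N g) : ℝ) ≤
        ((m - 1).choose (r - 1) : ℝ) * b := by
      intro Q hQ
      rw [hT, mem_filter, mem_powersetCard] at hQ
      refine (sum_le_card_nsmul _ _ b fun g hg => hbound g (mem_powersetCard.1 hg).2).trans ?_
      rw [card_powersetCard, hQ.1.2, nsmul_eq_mul]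
    refine (sum_le_card_nsmul _ _ _ h2).trans ?_
    rw [hT, card_filter_superset hf (by omega), nsmul_eq_mul, mul_assoc]
  have hsplit : #S = #((cliqueSets G r m).filter (f ⊆ ·)) + #B := by
    rw [hB, ← card_filter_add_card_filter_not (s := S) (fun Q => Q ∈ cliqueSets G r m)]
    congr 2
    ext Q
    simp only [hS, mem_filter, mem_powersetCard, mem_cliqueSets, subset_univ, true_and]
    tauto
  have hScard := card_filter_superset (n := n) hf hrm.le
  rw [← hS, hsplit] at hScard
  rw [← hScard]
  push_cast
  linarith

theorem exists_fractional_of_local_bound {q r n : ℕ} (hqr : r < q)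
    {G : Finset (Finset (Fin n))} (hG : ∀ e ∈ G, #e = r) {w D : ℝ} {g : Finset (Fin n) → ℝ}
    (hg : ∀ e, g e = #((cliqueSets G r (q + r)).filter (e ⊆ ·)))
    (hgpos : ∀ e ∈ G, 0 < g e)
    (hD : ∀ e ∈ G, |1 / 2 - w * #((cliqueSets G r q).filter (e ⊆ ·))| ≤ D * g e)
    (hw : D * ((n - q).choose r * 2 ^ r) ≤ w) :
    ∃ p : Finset (Fin n) → ℝ, (∀ Q, 0 ≤ p Q) ∧ (∀ Q, Q ∉ cliqueSets G r q → p Q = 0) ∧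
      ∀ e ∈ G, ∑ Q ∈ (cliqueSets G r q).filter (e ⊆ ·), p Q = 1 / 2 := by
  classical
  set d : Finset (Fin n) → ℝ := fun e =>
    1 / 2 - w * #((cliqueSets G r q).filter (e ⊆ ·)) with hd
  set corr : Finset (Fin n) → ℝ := fun Q => ∑ e ∈ G, d e / g e *
    ∑ V ∈ (cliqueSets G r (q + r)).filter (e ⊆ ·),
      if Q ⊆ V then decoderWeight q r #(Q ∩ e) else 0 with hcorr
  refine ⟨fun Q => if Q ∈ cliqueSets G r q then w + corr Q else 0, ?_, ?_, ?_⟩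
  · intro Q
    simp only
    split_ifs with hQ
    swap
    · exact le_rfl
    rw [mem_cliqueSets] at hQ
    by_cases hGe : G.Nonempty
    swap
    · rw [not_nonempty_iff_eq_empty] at hGe
      have hQr : ∃ e ⊆ Q, #e = r := exists_subset_card_eq (by omega)
      obtain ⟨e, heQ, her⟩ := hQr
      have := hQ.2 e heQ her
      simp [hGe] at this
    have hD0 : 0 ≤ D := by
      obtain ⟨e, he⟩ := hGe
      exact nonneg_of_mul_nonneg_left ((abs_nonneg _).trans (hD e he)) (hgpos e he)
    have habs : |corr Q| ≤ D * ((n - q).choose r * 2 ^ r) := by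
      calc |corr Q| ≤ ∑ e ∈ G, D * ∑ V ∈ (cliqueSets G r (q + r)).filter (e ⊆ ·),
            if Q ⊆ V then |decoderWeight q r #(Q ∩ e)| else 0 := by
            refine (abs_sum_le_sum_abs _ _).trans (sum_le_sum fun e he => ?_)
            rw [abs_mul, abs_div, abs_of_pos (hgpos e he)]
            refine mul_le_mul ((div_le_iff₀ (hgpos e he)).2 (hD e he)) ?_ (abs_nonneg _) hD0
            refine (abs_sum_le_sum_abs _ _).trans (sum_le_sum fun V _ => ?_)
            split_ifs <;> simp
        _ = D * ∑ V ∈ (cliqueSets G r (q + r)).filter (Q ⊆ ·),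
              ∑ e ∈ G.filter (· ⊆ V), |decoderWeight q r #(Q ∩ e)| := by
            rw [← mul_sum]
            congr 1
            simp only [sum_filter]
            rw [sum_comm]
            refine sum_congr rfl fun V _ => ?_
            by_cases hQV : Q ⊆ V <;> simp [hQV]
        _ ≤ D * ∑ V ∈ (cliqueSets G r (q + r)).filter (Q ⊆ ·), (2 : ℝ) ^ r := by
            refine mul_le_mul_of_nonneg_left (sum_le_sum fun V hV => ?_) hD0
            rw [mem_filter, mem_cliqueSets] at hV
            refine le_trans ?_ (sum_abs_decoderWeight_le hqr hV.1.1 hQ.1 hV.2)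
            refine sum_le_sum_of_subset_of_nonneg ?_ fun _ _ _ => abs_nonneg _
            intro e he
            rw [mem_filter] at he
            exact mem_powersetCard.2 ⟨he.2, hG e he.1⟩
        _ ≤ D * ((n - q).choose r * 2 ^ r) := by
            rw [sum_const, nsmul_eq_mul]
            refine mul_le_mul_of_nonneg_left (mul_le_mul_of_nonneg_right ?_ (by positivity)) hD0
            have h1 := card_filter_superset (n := n) (m := q + r) hQ.1 (by omega)
            rw [Nat.add_sub_cancel_left] at h1
            rw [← h1]
            exact_mod_cast card_le_card (filter_subset_filter _ (filter_subset _ _))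
    linarith [(abs_le.1 (habs.trans hw)).1]
  · intro Q hQ
    exact if_neg hQ
  · intro f hf
    have h1 : ∑ Q ∈ (cliqueSets G r q).filter (f ⊆ ·),
        (if Q ∈ cliqueSets G r q then w + corr Q else 0) =
          ∑ Q ∈ (cliqueSets G r q).filter (f ⊆ ·), (w + corr Q) :=
      sum_congr rfl fun Q hQ => if_pos (mem_filter.1 hQ).1
    have h2 : ∑ Q ∈ (cliqueSets G r q).filter (f ⊆ ·), corr Q = d f := by
      have h3 : ∀ e ∈ G, ∑ V ∈ (cliqueSets G r (q + r)).filter (e ⊆ ·),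
          ∑ Q ∈ (cliqueSets G r q).filter (f ⊆ ·),
            (if Q ⊆ V then decoderWeight q r #(Q ∩ e) else 0) = if e = f then g e else 0 := by
        intro e he
        have h4 : ∀ V ∈ (cliqueSets G r (q + r)).filter (e ⊆ ·),
            ∑ Q ∈ (cliqueSets G r q).filter (f ⊆ ·),
              (if Q ⊆ V then decoderWeight q r #(Q ∩ e) else 0) = if e = f then 1 else 0 := by
          intro V hV
          rw [mem_filter, mem_cliqueSets] at hV
          obtain ⟨⟨hVc, hVG⟩, heV⟩ := hV
          rw [← sum_filter]
          by_cases hfV : f ⊆ V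
          · rw [← sum_decoderWeight hqr hVc (hG e he) (hG f hf) heV hfV]
            refine sum_congr ?_ fun _ _ => rfl
            ext Q
            simp only [mem_filter, mem_cliqueSets, mem_powersetCard]
            constructor
            · rintro ⟨⟨⟨a1, a2⟩, a3⟩, a4⟩
              exact ⟨⟨a4, a1⟩, a3⟩
            · rintro ⟨⟨a4, a1⟩, a3⟩
              exact ⟨⟨⟨a1, fun h hh => hVG h (hh.trans a4)⟩, a3⟩, a4⟩
          · rw [if_neg (by rintro rfl; exact hfV heV)]
            refine sum_eq_zero fun Q hQ => ?_
            simp only [mem_filter] at hQ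
            exact absurd (hQ.1.2.trans hQ.2) hfV
        rw [sum_congr rfl h4, sum_const, nsmul_eq_mul, hg e]
        split_ifs <;> simp
      simp only [hcorr]
      rw [sum_comm]
      have h5 : ∀ e ∈ G, ∑ Q ∈ (cliqueSets G r q).filter (f ⊆ ·), d e / g e *
          ∑ V ∈ (cliqueSets G r (q + r)).filter (e ⊆ ·),
            (if Q ⊆ V then decoderWeight q r #(Q ∩ e) else 0) = if e = f then d e else 0 := by
        intro e he
        rw [← mul_sum, sum_comm, h3 e he]
        split_ifs
        · exact div_mul_cancel₀ _ (hgpos e he).ne'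
        · exact mul_zero _
      rw [sum_congr rfl h5, sum_ite_eq' G f d, if_pos hf]
    simp only
    rw [h1, sum_add_distrib, h2, sum_const, nsmul_eq_mul, hd]
    ring

/-- fractional core of regularity boosting: if `G ⊆ K^r_n` with `n`
sufficiently large (`n ≥ (4q)^{90q(2q)^r(6C(q,r))²}`) and `K^r_n \ G` is `c`-bounded
with `c < 2^{-3q}`, then there is an assignment `p : K^r_q(G) → [0,1]` with
`∑ {p_Q : e ∈ Q ∈ K^r_q(G)} = 1/2` for every edge `e` of `G`. -/
theorem stmt17 (q r n : ℕ) (hqr : r < q) (hr : 1 ≤ r)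
    (hn : (4 * q) ^ (90 * q * (2 * q) ^ r * (6 * q.choose r) ^ 2) ≤ n)
    (G : Finset (Finset (Fin n))) (hG : ∀ e ∈ G, e.card = r)
    (c : ℝ) (hc0 : 0 < c) (hc : c < (2 : ℝ) ^ (-(3 : ℤ) * (q : ℤ)))
    (hbound : ∀ f : Finset (Fin n), f.card = r - 1 →
      ((Finset.univ.filter (fun e : Finset (Fin n) =>
          e.card = r ∧ f ⊆ e ∧ e ∉ G)).card : ℝ) < c * n) :
    ∃ p : Finset (Fin n) → ℝ,
      (∀ Q, 0 ≤ p Q ∧ p Q ≤ 1) ∧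
      ∀ e ∈ G,
        ∑ Q ∈ Finset.univ.filter (fun Q : Finset (Fin n) => Q.card = q ∧ e ⊆ Q ∧
            ∀ f ⊆ Q, f.card = r → f ∈ G), p Q = 1 / 2 := by
  have hn4 : 4 * q ≤ n := by
    refine le_trans (Nat.le_self_pow ?_ _) hn
    have h1 := (Nat.choose_pos hqr.le).ne'
    have h2 : q ≠ 0 := by omega
    simp [h1, h2]
  have hc8 : c * 8 ^ q ≤ 1 := by
    have h8 : (8 : ℝ) ^ q * (2 : ℝ) ^ (-(3 : ℤ) * (q : ℤ)) = 1 := by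
      rw [neg_mul, zpow_neg, zpow_mul, zpow_natCast]
      norm_num
    have : (0 : ℝ) < 8 ^ q := by positivity
    nlinarith
  have hb : ∀ g : Finset (Fin n), #g = r - 1 →
      (#(univ.filter fun e : Finset (Fin n) => #e = r ∧ g ⊆ e ∧ e ∉ G) : ℝ) ≤ c * n :=
    fun g hg => (hbound g hg).le
  -- Passing from `(m - 1)`-sets to `m`-sets above a fixed `r`-set costs a factor at most `2 / n`.
  have hstep : ∀ m, r < m → m ≤ q + r →
      ((n - r).choose (m - 1 - r) : ℝ) * n ≤ 2 * ((m - r : ℕ) : ℝ) * (n - r).choose (m - r) := by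
    intro m h1 h2
    have h3 := Nat.choose_succ_right_eq (n - r) (m - 1 - r)
    rw [show m - 1 - r + 1 = m - r by omega] at h3
    have h4 : n ≤ 2 * (n - r - (m - 1 - r)) := by omega
    have h5 : (n - r).choose (m - 1 - r) * n ≤ 2 * (m - r) * (n - r).choose (m - r) := by
      calc (n - r).choose (m - 1 - r) * n
          ≤ (n - r).choose (m - 1 - r) * (2 * (n - r - (m - 1 - r))) := Nat.mul_le_mul_left _ h4
        _ = 2 * (m - r) * (n - r).choose (m - r) := by
          rw [mul_assoc 2, mul_comm (m - r), h3]
          ring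
    exact_mod_cast h5
  have hnum1 : 4 * ((q : ℝ) * (q + r - 1).choose (r - 1)) ≤ 8 ^ q := by
    have h1 : (q + r - 1).choose (r - 1) ≤ 2 ^ (q + r - 1) := Nat.choose_le_two_pow _ _
    have h2 : 2 ^ (q + r - 1) ≤ 2 ^ (2 * q - 2) := Nat.pow_le_pow_right (by norm_num) (by omega)
    have h3 : q ≤ 2 ^ q := Nat.lt_two_pow_self.le
    have h4 : 4 * (q * (q + r - 1).choose (r - 1)) ≤ 8 ^ q := by
      calc 4 * (q * (q + r - 1).choose (r - 1)) ≤ 4 * (2 ^ q * 2 ^ (2 * q - 2)) := by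
            gcongr
            exact h1.trans h2
        _ = 2 ^ (3 * q) := by
            rw [← pow_add, show 3 * q = (q + (2 * q - 2)) + 2 by omega, pow_add _ _ 2]
            ring
        _ = 8 ^ q := by
            rw [pow_mul]
            norm_num
    exact_mod_cast h4
  have hnum2 : 4 * (((q - r : ℕ) : ℝ) * (q - 1).choose (r - 1) * 2 ^ r * q.choose r) ≤ 8 ^ q := by
    have h1 : (q - 1).choose (r - 1) ≤ 2 ^ (q - 1) := Nat.choose_le_two_pow _ _
    have h2 : q - r ≤ 2 ^ (q - r - 1) := by
      have := Nat.lt_two_pow_self (n := q - r - 1)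
      omega
    have h3 : q.choose r ≤ 2 ^ q := Nat.choose_le_two_pow _ _
    have h4 : 4 * ((q - r) * (q - 1).choose (r - 1) * 2 ^ r * q.choose r) ≤ 8 ^ q := by
      calc 4 * ((q - r) * (q - 1).choose (r - 1) * 2 ^ r * q.choose r)
          ≤ 4 * (2 ^ (q - r - 1) * 2 ^ (q - 1) * 2 ^ r * 2 ^ q) := by gcongr
        _ = 2 ^ (3 * q) := by
            rw [← pow_add, ← pow_add, ← pow_add,
              show 3 * q = (q - r - 1 + (q - 1) + r + q) + 2 by omega, pow_add _ _ 2]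
            ring
        _ = 8 ^ q := by
            rw [pow_mul]
            norm_num
    exact_mod_cast h4
  have hK : (0 : ℝ) < (n - r).choose (q - r) := by
    exact_mod_cast Nat.choose_pos (by omega)
  have hM : (0 : ℝ) < (n - r).choose q := by
    exact_mod_cast Nat.choose_pos (by omega)
  have hMK : ((n - r).choose q : ℝ) * q.choose r =
      (n - r).choose (q - r) * (n - q).choose r := by
    have h1 := Nat.choose_mul (n := n - r) (k := q) (s := q - r) (by omega)
    rw [show n - r - (q - r) = n - q by omega, show q - (q - r) = r by omega,
      Nat.choose_symm hqr.le] at h1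
    exact_mod_cast h1
  have hgM : ∀ e ∈ G, ((n - r).choose q : ℝ) / 2 ≤
      #((cliqueSets G r (q + r)).filter (e ⊆ ·)) := by
    intro e he
    have h1 := choose_le_card_cliqueSets_add (m := q + r) (by omega) hb he (hG e he) hr
    have h2 := hstep (q + r) (by omega) le_rfl
    rw [Nat.add_sub_cancel] at h1 h2
    have h3 : ((n - r).choose (q + r - 1 - r) : ℝ) * (q + r - 1).choose (r - 1) * (c * n) ≤
        (n - r).choose q / 2 := by
      calc ((n - r).choose (q + r - 1 - r) : ℝ) * (q + r - 1).choose (r - 1) * (c * n)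
          = ((n - r).choose (q + r - 1 - r) * n) * ((q + r - 1).choose (r - 1) * c) := by ring
        _ ≤ (2 * q * (n - r).choose q) * ((q + r - 1).choose (r - 1) * c) := by gcongr
        _ = (n - r).choose q / 2 * (4 * (q * (q + r - 1).choose (r - 1)) * c) := by ring
        _ ≤ (n - r).choose q / 2 * (8 ^ q * c) := by gcongr
        _ ≤ (n - r).choose q / 2 * 1 := by
            gcongr
            linarith
        _ = (n - r).choose q / 2 := mul_one _
    linarith
  obtain ⟨p, hp0, hpz, hpe⟩ := exists_fractional_of_local_bound hqr hG
    (w := 1 / (2 * (n - r).choose (q - r)))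
    (D := 2 * ((q - r : ℕ) : ℝ) * (q - 1).choose (r - 1) * c / (n - r).choose q)
    (fun e => rfl) (fun e he => (half_pos hM).trans_le (hgM e he)) (by
      intro e he
      set k : ℝ := ((#((cliqueSets G r q).filter (e ⊆ ·)) : ℕ) : ℝ) with hk
      have hkK : k ≤ (n - r).choose (q - r) := by
        rw [← card_filter_superset (hG e he) hqr.le, hk]
        exact_mod_cast card_le_card (filter_subset_filter _ (filter_subset _ _))
      have h1 := choose_le_card_cliqueSets_add hqr hb he (hG e he) hr
      have h2 := hstep q hqr (by omega)
      have h3 : ((n - r).choose (q - r) : ℝ) - k ≤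
          2 * ((q - r : ℕ) : ℝ) * (q - 1).choose (r - 1) * c * (n - r).choose (q - r) := by
        calc ((n - r).choose (q - r) : ℝ) - k
            ≤ ((n - r).choose (q - 1 - r) * n) * ((q - 1).choose (r - 1) * c) := by linarith
          _ ≤ (2 * ((q - r : ℕ) : ℝ) * (n - r).choose (q - r)) * ((q - 1).choose (r - 1) * c) := by
              gcongr
          _ = _ := by ring
      have h4 : 1 / 2 - 1 / (2 * ((n - r).choose (q - r) : ℝ)) * k =
          ((n - r).choose (q - r) - k) / (2 * (n - r).choose (q - r)) := by
        field_simp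
      rw [h4, abs_of_nonneg (div_nonneg (by linarith) (by positivity))]
      calc ((n - r).choose (q - r) - k) / (2 * (n - r).choose (q - r))
          ≤ 2 * ((q - r : ℕ) : ℝ) * (q - 1).choose (r - 1) * c * (n - r).choose (q - r) /
              (2 * (n - r).choose (q - r)) := by gcongr
        _ = 2 * ((q - r : ℕ) : ℝ) * (q - 1).choose (r - 1) * c / (n - r).choose q *
              ((n - r).choose q / 2) := by field_simp
        _ ≤ _ := by
            gcongr
            exact hgM e he)
    (by
      rw [div_mul_eq_mul_div, div_le_div_iff₀ hM (by positivity)]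
      calc 2 * ((q - r : ℕ) : ℝ) * (q - 1).choose (r - 1) * c * ((n - q).choose r * 2 ^ r) *
            (2 * (n - r).choose (q - r))
          = 4 * (((q - r : ℕ) : ℝ) * (q - 1).choose (r - 1) * 2 ^ r * q.choose r) * c *
              (n - r).choose q := by
            linear_combination -4 * ((q - r : ℕ) : ℝ) * (q - 1).choose (r - 1) * c * 2 ^ r * hMK
        _ ≤ 8 ^ q * c * (n - r).choose q := by gcongr
        _ ≤ 1 * (n - r).choose q := by
            gcongr
            linarith)
  refine ⟨p, fun Q => ⟨hp0 Q, ?_⟩, fun e he => ?_⟩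
  · by_cases hQ : Q ∈ cliqueSets G r q
    · obtain ⟨e, heQ, her⟩ : ∃ e ⊆ Q, #e = r :=
        exists_subset_card_eq (by rw [(mem_cliqueSets.1 hQ).1]; exact hqr.le)
      have h1 := single_le_sum (fun Q _ => hp0 Q) (mem_filter.2 ⟨hQ, heQ⟩)
      rw [hpe e ((mem_cliqueSets.1 hQ).2 e heQ her)] at h1
      linarith
    · rw [hpz Q hQ]
      exact zero_le_one
  · rw [← hpe e he]
    refine sum_congr ?_ fun _ _ => rfl
    ext Q
    simp only [mem_filter, mem_univ, true_and, mem_cliqueSets]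
    tauto
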